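/- arXiv:2604.20320 — 6 statements merged into one kernel-verified Lean document; each statement's English description precedes it below -/
import Mathlib

section
/- Let n ≥ 1, let a > 0, let v ∈ ℝⁿ with ‖v‖ = 1, and let (t₀, x₀) ∈ ℝ × ℝⁿ satisfy |t₀| + ‖x₀‖ < a/2. Then for every s ∈ ℝ, ‖x₀ + s • v‖ < (a + √(a² + 4 (t₀ + s)²)) / 2; that is, the null geodesic s ↦ (t₀ + s, x₀ + s v) stays strictly inside the timelike hyperboloid {(t,x) : ‖x‖ = (a + √(a² + 4 t²))/2}. -/
/-- A null geodesic `s ↦ (t₀ + s, x₀ + s v)` of Minkowski space starting in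
the diamond `{(t,x) : |t| + ‖x‖ < a/2}` stays strictly inside the timelike hyperboloid
`{(t,x) : ‖x‖ = (a + √(a² + 4t²))/2}`. -/
theorem minkowski_null_geodesic_inside_hyperboloid
    (n : ℕ) (hn : 1 ≤ n) (a : ℝ) (ha : 0 < a)
    (v : EuclideanSpace ℝ (Fin n)) (hv : ‖v‖ = 1)
    (t₀ : ℝ) (x₀ : EuclideanSpace ℝ (Fin n))
    (hU : |t₀| + ‖x₀‖ < a / 2) :
    ∀ s : ℝ, ‖x₀ + s • v‖ < (a + Real.sqrt (a ^ 2 + 4 * (t₀ + s) ^ 2)) / 2 := by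
  intro s
  have h_norm : ‖x₀ + s • v‖ ≤ ‖x₀‖ + |s| := by
    simpa [norm_smul, hv] using norm_add_le x₀ (s • v)
  have h_time : |s| ≤ |t₀ + s| + |t₀| := by
    simpa using abs_sub (t₀ + s) t₀
  have h_sqrt : 2 * |t₀ + s| ≤ Real.sqrt (a ^ 2 + 4 * (t₀ + s) ^ 2) := by
    apply Real.le_sqrt_of_sq_le
    rw [mul_pow, sq_abs]
    nlinarith [sq_nonneg a]
  linarith
end

section
/- Let d ≥ 2 and let g : ℝ^d → Matrix (Fin d) (Fin d) ℝ be a smooth map such that for every x, g(x) is symmetric and there exists an invertible matrix A with g(x) = Aᵀ η A, where η = diag(−1, 1, …, 1) (so g is a smooth Lorentzian metric on ℝ^d). Let T : ℝ^d → ℝ^d be a smooth vector field with T(x)ᵀ g(x) T(x) < 0 for all x (a time orientation). For p, q ∈ ℝ^d say q ∈ J⁺(p) if q = p or there is a piecewise continuously differentiable curve γ : [0,1] → ℝ^d with γ(0) = p, γ(1) = q, and for all s: γ̇(s)ᵀ g(γ(s)) γ̇(s) ≤ 0, γ̇(s) ≠ 0, and γ̇(s)ᵀ g(γ(s)) T(γ(s))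 < 0; say q ∈ I⁺(p) if moreover such a curve exists with γ̇(s)ᵀ g(γ(s)) γ̇(s) < 0 for all s. Then for every nonempty open set U ⊆ ℝ^d, J⁺(U) := ⋃_{p ∈ U} J⁺(p) equals I⁺(U) := ⋃_{p ∈ U} I⁺(p). The analogous statement holds for the causal and chronological pasts, defined with past-directed curves (γ̇ᵀ g T > 0). -/
open Matrix Set

noncomputable section

/-- The Minkowski form `η = diag(−1, 1, …, 1)` on `ℝ^d`. -/
def minkMatrix (d : ℕ) : Matrix (Fin d) (Fin d) ℝ :=
  Matrix.diagonal (fun i => if (i : ℕ) = 0 then (-1 : ℝ) else 1)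

/-- `g` is a smooth Lorentzian metric on `ℝ^d`: a smooth field of symmetric matrices,
each congruent to the Minkowski form `η = diag(−1, 1, …, 1)`. -/
def IsLorentzMetric (d : ℕ) (g : (Fin d → ℝ) → Matrix (Fin d) (Fin d) ℝ) : Prop :=
  (∀ i j, ContDiff ℝ (⊤ : ℕ∞) (fun x => g x i j)) ∧ ∀ x, (g x).IsSymm ∧
    ∃ A : Matrix (Fin d) (Fin d) ℝ, IsUnit A ∧ g x = Aᵀ * minkMatrix d * A

/-- `T` is a time orientation for `g`: a smooth vector field that is everywhere timelike. -/
def IsTimeOrientation (d : ℕ) (g : (Fin d → ℝ) → Matrix (Fin d) (Fin d) ℝ)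
    (T : (Fin d → ℝ) → Fin d → ℝ) : Prop :=
  ContDiff ℝ (⊤ : ℕ∞) T ∧ ∀ x, T x ⬝ᵥ (g x).mulVec (T x) < 0

/-- There is a piecewise `C¹` curve `γ : [0,1] → ℝ^d` from `p` to `q` that is causal
(timelike if `timelike = true`) and future-directed (past-directed if `future = false`)
with respect to the metric `g` and the time orientation `T`.  The curve is `C¹` on each
subinterval `[sᵢ, sᵢ₊₁]` of a partition `0 = s₀ < s₁ < ⋯ = 1`, and on each such subinterval
its (one-sided, within the subinterval) derivative `v` satisfies `vᵀ g v ≤ 0` (resp. `< 0`),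
`v ≠ 0`, and `vᵀ g T < 0` (resp. `> 0` in the past-directed case). -/
def CurveReach (d : ℕ) (g : (Fin d → ℝ) → Matrix (Fin d) (Fin d) ℝ)
    (T : (Fin d → ℝ) → Fin d → ℝ) (timelike future : Bool)
    (p q : Fin d → ℝ) : Prop :=
  ∃ (m : ℕ) (s : Fin (m + 2) → ℝ) (γ : ℝ → Fin d → ℝ),
    StrictMono s ∧ s 0 = 0 ∧ s (Fin.last (m + 1)) = 1 ∧
    γ 0 = p ∧ γ 1 = q ∧
    ∀ i : Fin (m + 1),
      ContDiffOn ℝ 1 γ (Icc (s i.castSucc) (s i.succ)) ∧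
      ∀ t ∈ Icc (s i.castSucc) (s i.succ),
        (if timelike = true then
            derivWithin γ (Icc (s i.castSucc) (s i.succ)) t ⬝ᵥ
              (g (γ t)).mulVec (derivWithin γ (Icc (s i.castSucc) (s i.succ)) t) < 0
          else
            derivWithin γ (Icc (s i.castSucc) (s i.succ)) t ⬝ᵥ
              (g (γ t)).mulVec (derivWithin γ (Icc (s i.castSucc) (s i.succ)) t) ≤ 0) ∧
        derivWithin γ (Icc (s i.castSucc) (s i.succ)) t ≠ 0 ∧
        (if future = true then
            derivWithin γ (Icc (s i.castSucc) (s i.succ)) t ⬝ᵥ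
              (g (γ t)).mulVec (T (γ t)) < 0
          else
            0 < derivWithin γ (Icc (s i.castSucc) (s i.succ)) t ⬝ᵥ
              (g (γ t)).mulVec (T (γ t)))

/-- The causal future `J⁺(U)` (or causal past `J⁻(U)` if `future = false`) of a set `U`:
`U` itself together with all endpoints of future-directed (resp. past-directed) causal
curves starting in `U`. -/
def causalSet (d : ℕ) (g : (Fin d → ℝ) → Matrix (Fin d) (Fin d) ℝ)
    (T : (Fin d → ℝ) → Fin d → ℝ) (future : Bool)
    (U : Set (Fin d → ℝ)) : Set (Fin d → ℝ) :=
  {q | ∃ p ∈ U, q = p ∨ CurveReach d g T false future p q}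

/-- The chronological future `I⁺(U)` (or chronological past `I⁻(U)` if `future = false`)
of a set `U`: all endpoints of future-directed (resp. past-directed) timelike curves
starting in `U`. -/
def chronoSet (d : ℕ) (g : (Fin d → ℝ) → Matrix (Fin d) (Fin d) ℝ)
    (T : (Fin d → ℝ) → Fin d → ℝ) (future : Bool)
    (U : Set (Fin d → ℝ)) : Set (Fin d → ℝ) :=
  {q | ∃ p ∈ U, CurveReach d g T true future p q}

open Filter Topology

section Perturbation

variable {X E : Type*} [TopologicalSpace X] [CompactSpace X]
  [NormedAddCommGroup E] [NormedSpace ℝ E]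

lemma eventually_forall_neg_of_continuous {F : X → ℝ → ℝ}
    (hF : Continuous (fun z : ℝ × X => F z.2 z.1)) (h0 : ∀ s, F s 0 < 0) :
    ∀ᶠ e in 𝓝 (0 : ℝ), ∀ s, F s e < 0 := by
  have := (isCompact_univ (X := X)).eventually_forall_of_forall_eventually
    (x₀ := (0 : ℝ)) (P := fun e s => F s e < 0)
    (fun s _ => hF.continuousAt.eventually_lt continuousAt_const (h0 s))
  simpa using this

lemma eventually_forall_neg_of_fderiv_neg {F : E → ℝ} (hF : ContDiff ℝ 1 F) {y h : X → E}
    (hy : Continuous y) (hh : Continuous h) (h0 : ∀ s, F (y s) ≤ 0)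
    (h1 : ∀ s, fderiv ℝ F (y s) (h s) < 0) :
    ∀ᶠ e in 𝓝[>] (0 : ℝ), ∀ s, F (y s + e • h s) < 0 := by
  have hc : Continuous (fun z : ℝ × X => fderiv ℝ F (y z.2 + z.1 • h z.2) (h z.2)) :=
    ((hF.continuous_fderiv one_ne_zero).comp (by fun_prop)).clm_apply (by fun_prop)
  have key := eventually_forall_neg_of_continuous
    (F := fun s e => fderiv ℝ F (y s + e • h s) (h s)) hc (by simpa using h1)
  obtain ⟨δ, hδ, hball⟩ := Metric.eventually_nhds_iff.1 key
  filter_upwards [Ioo_mem_nhdsGT hδ] with e he s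
  have hd : ∀ t, HasDerivAt (fun t : ℝ => F (y s + t • h s))
      (fderiv ℝ F (y s + t • h s) (h s)) t := by
    intro t
    have h2 : HasDerivAt (fun t : ℝ => y s + t • h s) (h s) t := by
      simpa using ((hasDerivAt_id t).smul_const (h s)).const_add (y s)
    exact ((hF.differentiable one_ne_zero).differentiableAt.hasFDerivAt).comp_hasDerivAt t h2
  have hanti : StrictAntiOn (fun t : ℝ => F (y s + t • h s)) (Icc 0 e) := by
    refine strictAntiOn_of_deriv_neg (convex_Icc 0 e)
      (fun t _ => (hd t).continuousAt.continuousWithinAt) ?_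
    intro t ht
    rw [interior_Icc] at ht
    rw [(hd t).deriv]
    refine hball ?_ s
    rw [Real.dist_eq, sub_zero, abs_of_pos ht.1]
    exact ht.2.trans he.2
  have := hanti (left_mem_Icc.2 he.1.le) (right_mem_Icc.2 he.1.le) he.1
  simp only [zero_smul, add_zero] at this
  exact this.trans_le (h0 s)

end Perturbation

section MetricForms

variable {d : ℕ} {g : (Fin d → ℝ) → Matrix (Fin d) (Fin d) ℝ} {T : (Fin d → ℝ) → Fin d → ℝ}

lemma contDiff_dotProduct_mulVec (hg : ∀ i j, ContDiff ℝ 1 (fun x => g x i j))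
    {E : Type*} [NormedAddCommGroup E] [NormedSpace ℝ E] {x v w : E → Fin d → ℝ}
    (hx : ContDiff ℝ 1 x) (hv : ContDiff ℝ 1 v) (hw : ContDiff ℝ 1 w) :
    ContDiff ℝ 1 (fun z => v z ⬝ᵥ (g (x z)).mulVec (w z)) := by
  simp only [dotProduct, mulVec]
  have hv' := contDiff_pi.1 hv
  have hw' := contDiff_pi.1 hw
  exact ContDiff.sum fun i _ => (hv' i).mul
    (ContDiff.sum fun j _ => ((hg i j).comp hx).mul (hw' j))

lemma fderiv_quadratic_snd (hg : ∀ i j, ContDiff ℝ 1 (fun x => g x i j))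
    (hs : ∀ x, (g x).IsSymm) (x v w : Fin d → ℝ) :
    fderiv ℝ (fun z : (Fin d → ℝ) × (Fin d → ℝ) => z.2 ⬝ᵥ (g z.1).mulVec z.2) (x, v) (0, w)
      = 2 * (v ⬝ᵥ (g x).mulVec w) := by
  have hQ := contDiff_dotProduct_mulVec hg
    (contDiff_fst (𝕜 := ℝ) (n := 1) (E := Fin d → ℝ) (F := Fin d → ℝ)) contDiff_snd contDiff_snd
  have hline : HasDerivAt (fun t : ℝ => (x, v) + t • ((0 : Fin d → ℝ), w)) (0, w) 0 := by
    simpa using ((hasDerivAt_id (0 : ℝ)).smul_const ((0 : Fin d → ℝ), w)).const_add (x, v)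
  have h1 := HasFDerivAt.comp_hasDerivAt_of_eq (0 : ℝ)
    (hQ.differentiable one_ne_zero (x, v)).hasFDerivAt hline (by simp)
  have hsymm : w ⬝ᵥ (g x).mulVec v = v ⬝ᵥ (g x).mulVec w := by
    rw [dotProduct_comm, ← vecMul_transpose, (hs x).eq, ← dotProduct_mulVec]
  have h2 : HasDerivAt (fun t : ℝ => v ⬝ᵥ (g x).mulVec v + t * (2 * (v ⬝ᵥ (g x).mulVec w))
      + t ^ 2 * (w ⬝ᵥ (g x).mulVec w)) (2 * (v ⬝ᵥ (g x).mulVec w)) 0 := by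
    refine HasDerivAt.congr_deriv ((((hasDerivAt_id (0 : ℝ)).mul_const (2 * (v ⬝ᵥ (g x).mulVec w))).const_add
      (v ⬝ᵥ (g x).mulVec v)).add (((hasDerivAt_id (0 : ℝ)).pow 2).mul_const
        (w ⬝ᵥ (g x).mulVec w))) ?_
    simp
  refine h1.unique (h2.congr_of_eventuallyEq (Eventually.of_forall fun t => ?_))
  simp only [Function.comp, Prod.fst_add, Prod.snd_add, Prod.smul_fst, Prod.smul_snd, smul_zero,
    add_zero, mulVec_add, mulVec_smul, dotProduct_add, add_dotProduct, smul_dotProduct,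
    dotProduct_smul, hsymm, smul_eq_mul]
  ring

/-- The curve `γ` pushed along `-T` by an amount that vanishes at parameter `1`. -/
def pushedCurve (T : (Fin d → ℝ) → Fin d → ℝ) (γ : ℝ → Fin d → ℝ) (K e : ℝ) (t : ℝ) :
    Fin d → ℝ :=
  γ t + e • ((1 - Real.exp (K * (1 - t))) • T (γ t))

lemma pushedCurve_timelike_eventually (hg : ∀ i j, ContDiff ℝ 1 (fun x => g x i j))
    (hs : ∀ x, (g x).IsSymm) (hT : ContDiff ℝ 1 T) {γ : ℝ → Fin d → ℝ} {a b : ℝ}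
    (hab : a < b) (hb : b ≤ 1) (hγ : ContDiffOn ℝ 1 γ (Icc a b))
    (hc : ∀ t ∈ Icc a b, derivWithin γ (Icc a b) t ⬝ᵥ
      (g (γ t)).mulVec (derivWithin γ (Icc a b) t) ≤ 0)
    (hf : ∀ t ∈ Icc a b, derivWithin γ (Icc a b) t ⬝ᵥ (g (γ t)).mulVec (T (γ t)) < 0) :
    ∀ᶠ K in atTop, ∀ᶠ e in 𝓝[>] (0 : ℝ),
      ContDiffOn ℝ 1 (pushedCurve T γ K e) (Icc a b) ∧ ∀ t ∈ Icc a b,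
        derivWithin (pushedCurve T γ K e) (Icc a b) t ⬝ᵥ (g (pushedCurve T γ K e t)).mulVec
          (derivWithin (pushedCurve T γ K e) (Icc a b) t) < 0 ∧
        derivWithin (pushedCurve T γ K e) (Icc a b) t ⬝ᵥ (g (pushedCurve T γ K e t)).mulVec
          (T (pushedCurve T γ K e t)) < 0 := by
  set I := Icc a b with hI
  have hu : UniqueDiffOn ℝ I := uniqueDiffOn_Icc hab
  have hw : ContDiffOn ℝ 1 (T ∘ γ) I := hT.comp_contDiffOn hγ
  set Q : (Fin d → ℝ) × (Fin d → ℝ) → ℝ := fun z => z.2 ⬝ᵥ (g z.1).mulVec z.2 with hQdef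
  have hQ : ContDiff ℝ 1 Q := contDiff_dotProduct_mulVec hg contDiff_fst contDiff_snd contDiff_snd
  have hR : ContDiff ℝ 1 (fun z : (Fin d → ℝ) × (Fin d → ℝ) =>
      z.2 ⬝ᵥ (g z.1).mulVec (T z.1)) :=
    contDiff_dotProduct_mulVec hg contDiff_fst contDiff_snd (hT.comp contDiff_fst)
  have hx : Continuous (fun t : I => γ t) := hγ.continuousOn.domRestrict
  have hv : Continuous (fun t : I => derivWithin γ I t) :=
    (hγ.continuousOn_derivWithin hu le_rfl).domRestrict
  have hW : Continuous (fun t : I => T (γ t)) := hw.continuousOn.domRestrict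
  have hW' : Continuous (fun t : I => derivWithin (T ∘ γ) I t) :=
    (hw.continuousOn_derivWithin hu le_rfl).domRestrict
  set B : I → ℝ := fun t =>
    fderiv ℝ Q (γ t, derivWithin γ I t) (T (γ t), derivWithin (T ∘ γ) I t) with hB
  have hBc : Continuous B := ((hQ.continuous_fderiv one_ne_zero).comp
    (hx.prodMk hv)).clm_apply (hW.prodMk hW')
  set R : I → ℝ := fun t => derivWithin γ I t ⬝ᵥ (g (γ t)).mulVec (T (γ t)) with hRdef
  have hRc : Continuous R := hR.continuous.comp (hx.prodMk hv)
  have : CompactSpace I := isCompact_iff_compactSpace.1 isCompact_Icc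
  have hRneg : ∀ t : I, R t < 0 := fun t => hf t t.2
  obtain ⟨M, hM⟩ := (isCompact_univ (X := I)).exists_bound_of_continuousOn
    (f := fun t => B t / R t) (hBc.div hRc fun t => (hRneg t).ne).continuousOn
  filter_upwards [eventually_gt_atTop M, eventually_gt_atTop 0] with K hKM hK0
  set φ : ℝ → ℝ := fun t => 1 - Real.exp (K * (1 - t)) with hφ
  set ψ : ℝ → ℝ := fun t => K * Real.exp (K * (1 - t)) with hψ
  have hφc : ContDiff ℝ 1 φ := by
    rw [hφ]; fun_prop
  have hφc' : Continuous φ := hφc.continuous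
  have hψc : Continuous ψ := by rw [hψ]; fun_prop
  have hφd : ∀ t, HasDerivAt φ (ψ t) t := by
    intro t
    have := ((((hasDerivAt_id t).const_sub 1).const_mul K).exp).const_sub 1
    refine this.congr_deriv ?_
    simp only [hψ, id]
    ring
  set y : I → (Fin d → ℝ) × (Fin d → ℝ) := fun t => (γ t, derivWithin γ I t) with hy
  set h : I → (Fin d → ℝ) × (Fin d → ℝ) := fun t =>
    (φ t • T (γ t), ψ t • T (γ t) + φ t • derivWithin (T ∘ γ) I t) with hh
  have hyc : Continuous y := hx.prodMk hv
  have hhc : Continuous h := by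
    have h1 : Continuous (fun t : I => φ t) := hφc'.comp continuous_subtype_val
    have h2 : Continuous (fun t : I => ψ t) := hψc.comp continuous_subtype_val
    exact (h1.smul hW).prodMk ((h2.smul hW).add (h1.smul hW'))
  have hneg : ∀ t, fderiv ℝ Q (y t) (h t) < 0 := by
    intro t
    have hsplit : h t = ψ t • ((0 : Fin d → ℝ), T (γ t)) +
        φ t • (T (γ t), derivWithin (T ∘ γ) I t) := by
      ext <;> simp [hh]
    rw [hsplit, map_add, map_smul, map_smul, hQdef, fderiv_quadratic_snd hg hs]
    change K * Real.exp (K * (1 - t)) * (2 * R t) + (1 - Real.exp (K * (1 - t))) * B t < 0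
    have hbd := abs_le.1 (hM t (mem_univ t))
    have hE : 1 ≤ Real.exp (K * (1 - t)) :=
      Real.one_le_exp (mul_nonneg hK0.le (by linarith [t.2.2]))
    have hBR : B t = (B t / R t) * R t := by field_simp [(hRneg t).ne]
    set r := B t / R t
    rw [hBR]
    have hpos : 0 < 2 * K * Real.exp (K * (1 - t)) - (Real.exp (K * (1 - t)) - 1) * r := by
      nlinarith [mul_nonneg (sub_nonneg.2 hE) (sub_nonneg.2 (hbd.2.trans hKM.le)),
        mul_pos hK0 (zero_lt_one.trans_le hE)]
    nlinarith [mul_neg_of_pos_of_neg hpos (hRneg t)]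
  have ev1 := eventually_forall_neg_of_fderiv_neg hQ hyc hhc (fun t => hc t t.2) hneg
  have ev2 := eventually_forall_neg_of_continuous
    (F := fun (t : I) (e : ℝ) => (y t + e • h t).2 ⬝ᵥ (g (y t + e • h t).1).mulVec
      (T (y t + e • h t).1))
    (hR.continuous.comp (by fun_prop : Continuous fun z : ℝ × I => y z.2 + z.1 • h z.2))
    (by simpa [hy] using hRneg)
  filter_upwards [ev1, ev2.filter_mono nhdsWithin_le_nhds] with e he1 he2
  refine ⟨hγ.add ((hφc.contDiffOn.smul hw).const_smul e), fun t ht => ?_⟩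
  have hd : derivWithin (pushedCurve T γ K e) I t = (y ⟨t, ht⟩ + e • h ⟨t, ht⟩).2 := by
    have hγd := (hγ.differentiableOn one_ne_zero t ht).hasDerivWithinAt
    have hwd := (hw.differentiableOn one_ne_zero t ht).hasDerivWithinAt
    have := hγd.add (((hφd t).hasDerivWithinAt.smul hwd).const_smul e)
    rw [HasDerivWithinAt.derivWithin (f := pushedCurve T γ K e) this (hu t ht)]
    simp only [hy, hh, Prod.snd_add, Prod.smul_snd, Function.comp]
    rw [add_comm (φ t • _)]
  rw [hd]
  exact ⟨he1 ⟨t, ht⟩, he2 ⟨t, ht⟩⟩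

lemma CurveReach.of_timelike {future : Bool} {p q : Fin d → ℝ}
    (h : CurveReach d g T true future p q) : CurveReach d g T false future p q := by
  obtain ⟨m, s, γ, hs, h0, h1, hp, hq, H⟩ := h
  refine ⟨m, s, γ, hs, h0, h1, hp, hq, fun i => ⟨(H i).1, fun t ht => ?_⟩⟩
  obtain ⟨ha, hb⟩ := (H i).2 t ht
  exact ⟨by simpa using le_of_lt (by simpa using ha), hb⟩

lemma curveReach_past_iff {timelike : Bool} {p q : Fin d → ℝ} :
    CurveReach d g T timelike false p q ↔
      CurveReach d g (fun x => -T x) timelike true p q := by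
  simp [CurveReach, mulVec_neg, dotProduct_neg]

lemma exists_mem_timelike_of_causal (hg : ∀ i j, ContDiff ℝ 1 (fun x => g x i j))
    (hs : ∀ x, (g x).IsSymm) (hT : ContDiff ℝ 1 T) {U : Set (Fin d → ℝ)} (hU : IsOpen U)
    {p q : Fin d → ℝ} (hp : p ∈ U) (h : CurveReach d g T false true p q) :
    ∃ p' ∈ U, CurveReach d g T true true p' q := by
  obtain ⟨m, s, γ, hsm, h0, h1, hγ0, hγ1, H⟩ := h
  have hpieces : ∀ i : Fin (m + 1), _ := fun i =>
    pushedCurve_timelike_eventually (g := g) (T := T) (γ := γ) hg hs hT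
      (hsm (Fin.castSucc_lt_succ (i := i))) (h1 ▸ hsm.monotone (Fin.le_last _)) (H i).1
      (fun t ht => by simpa using ((H i).2 t ht).1)
      (fun t ht => by simpa using ((H i).2 t ht).2.2)
  obtain ⟨K, hK⟩ := (eventually_all.2 hpieces).exists
  have hstart : ∀ᶠ e in 𝓝[>] (0 : ℝ), pushedCurve T γ K e 0 ∈ U := by
    have hcont : Continuous (fun e : ℝ => pushedCurve T γ K e 0) := by
      unfold pushedCurve; fun_prop
    refine (hcont.tendsto 0).eventually (hU.mem_nhds ?_) |>.filter_mono nhdsWithin_le_nhds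
    simpa [pushedCurve, hγ0] using hp
  obtain ⟨e, he, heU⟩ := ((eventually_all.2 hK).and hstart).exists
  refine ⟨_, heU, m, s, pushedCurve T γ K e, hsm, h0, h1, rfl, ?_, fun i =>
    ⟨(he i).1, fun t ht => ?_⟩⟩
  · simp [pushedCurve, hγ1]
  · obtain ⟨ha, hb⟩ := (he i).2 t ht
    refine ⟨by simpa using ha, fun h0 => ?_, by simpa using hb⟩
    simp [h0] at ha

lemma exists_mem_timelike_self (hg : ∀ i j, ContDiff ℝ 1 (fun x => g x i j))
    (hT : ContDiff ℝ 1 T) {U : Set (Fin d → ℝ)} (hU : IsOpen U)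
    {p : Fin d → ℝ} (hp : p ∈ U) (hTp : T p ⬝ᵥ (g p).mulVec (T p) < 0) :
    ∃ p' ∈ U, CurveReach d g T true true p' p := by
  have hcont : Continuous (fun u : ℝ => p + u • T p) := by fun_prop
  have e1 : ∀ᶠ u in 𝓝 (0 : ℝ), p + u • T p ∈ U :=
    (hcont.tendsto 0).eventually (hU.mem_nhds (by simpa using hp))
  have hline : ContDiff ℝ 1 (fun u : ℝ => p + u • T p) := by fun_prop
  have e2 : ∀ᶠ u in 𝓝 (0 : ℝ), T p ⬝ᵥ (g (p + u • T p)).mulVec (T p) < 0 :=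
    (contDiff_dotProduct_mulVec hg hline contDiff_const contDiff_const).continuous.continuousAt
      |>.eventually_lt continuousAt_const (by simpa using hTp)
  have e3 : ∀ᶠ u in 𝓝 (0 : ℝ), T p ⬝ᵥ (g (p + u • T p)).mulVec (T (p + u • T p)) < 0 :=
    (contDiff_dotProduct_mulVec hg hline contDiff_const (hT.comp hline)).continuous.continuousAt
      |>.eventually_lt continuousAt_const (by simpa using hTp)
  obtain ⟨δ, hδ, hball⟩ := Metric.eventually_nhds_iff.1 (e1.and (e2.and e3))
  have hin : ∀ t ∈ Icc (0 : ℝ) 1, dist (δ / 2 * (t - 1)) 0 < δ := by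
    intro t ht
    rw [Real.dist_eq, sub_zero, abs_lt]
    constructor <;> nlinarith [ht.1, ht.2]
  set γ : ℝ → Fin d → ℝ := fun t => p + (δ / 2 * (t - 1)) • T p with hγ
  have hd : ∀ t ∈ Icc (0 : ℝ) 1, derivWithin γ (Icc 0 1) t = (δ / 2) • T p := by
    intro t ht
    have : HasDerivAt γ ((δ / 2) • T p) t := by
      refine HasDerivAt.congr_deriv (((((hasDerivAt_id t).sub_const 1).const_mul
        (δ / 2)).smul_const (T p)).const_add p) ?_
      simp
    exact this.hasDerivWithinAt.derivWithin (uniqueDiffOn_Icc zero_lt_one t ht)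
  refine ⟨γ 0, (hball (hin 0 (by simp))).1, 0, ![0, 1], γ, ?_, rfl, rfl, rfl, by simp [hγ], ?_⟩
  · rw [Fin.strictMono_iff_lt_succ]
    simp
  · intro i
    obtain rfl : i = 0 := Subsingleton.elim (α := Fin 1) _ _
    change ContDiffOn ℝ 1 γ (Icc 0 1) ∧ ∀ t ∈ Icc (0 : ℝ) 1, _
    refine ⟨by rw [hγ]; fun_prop, fun t ht => ?_⟩
    obtain ⟨-, h2, h3⟩ := hball (hin t ht)
    change (if true = true then derivWithin γ (Icc 0 1) t ⬝ᵥ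
      (g (γ t)).mulVec (derivWithin γ (Icc 0 1) t) < 0 else _) ∧
      derivWithin γ (Icc 0 1) t ≠ 0 ∧ (if true = true then derivWithin γ (Icc 0 1) t ⬝ᵥ
        (g (γ t)).mulVec (T (γ t)) < 0 else _)
    rw [hd t ht, if_pos rfl, if_pos rfl]
    simp only [mulVec_smul, smul_dotProduct, dotProduct_smul, smul_eq_mul]
    have hδ2 : 0 < δ / 2 := half_pos hδ
    refine ⟨mul_neg_of_pos_of_neg hδ2 (mul_neg_of_pos_of_neg hδ2 h2), fun h0 => ?_,
      mul_neg_of_pos_of_neg hδ2 h3⟩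
    rw [(smul_eq_zero.1 h0).resolve_left hδ2.ne'] at hTp
    simp at hTp

lemma causalSet_future_eq_chronoSet (hg : IsLorentzMetric d g) (hT : IsTimeOrientation d g T)
    {U : Set (Fin d → ℝ)} (hU : IsOpen U) :
    causalSet d g T true U = chronoSet d g T true U := by
  have hle : (1 : WithTop ℕ∞) ≤ ((⊤ : ℕ∞) : WithTop ℕ∞) := by exact_mod_cast le_top
  have hg1 : ∀ i j, ContDiff ℝ 1 (fun x => g x i j) := fun i j => (hg.1 i j).of_le hle
  have hT1 : ContDiff ℝ 1 T := hT.1.of_le hle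
  ext q
  constructor
  · rintro ⟨p, hp, rfl | h⟩
    · exact exists_mem_timelike_self hg1 hT1 hU hp (hT.2 _)
    · exact exists_mem_timelike_of_causal hg1 (fun x => (hg.2 x).1) hT1 hU hp h
  · rintro ⟨p, hp, h⟩
    exact ⟨p, hp, Or.inr h.of_timelike⟩

lemma IsTimeOrientation.neg (hT : IsTimeOrientation d g T) :
    IsTimeOrientation d g (fun x => -T x) :=
  ⟨hT.1.neg, fun x => by simpa [mulVec_neg] using hT.2 x⟩

end MetricForms

/-- For a smooth time-oriented Lorentzian metric on `ℝ^d` (`d ≥ 2`) and any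
nonempty open set `U`, the causal future `J⁺(U)` equals the chronological future `I⁺(U)`,
and likewise `J⁻(U) = I⁻(U)`. -/
theorem causal_eq_chrono_of_open
    (d : ℕ) (hd : 2 ≤ d)
    (g : (Fin d → ℝ) → Matrix (Fin d) (Fin d) ℝ) (hg : IsLorentzMetric d g)
    (T : (Fin d → ℝ) → Fin d → ℝ) (hT : IsTimeOrientation d g T) :
    ∀ U : Set (Fin d → ℝ), U.Nonempty → IsOpen U →
      causalSet d g T true U = chronoSet d g T true U ∧
      causalSet d g T false U = chronoSet d g T false U := by
  intro U _ hU
  refine ⟨causalSet_future_eq_chronoSet hg hT hU, ?_⟩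
  have h := causalSet_future_eq_chronoSet hg hT.neg hU
  simpa only [causalSet, chronoSet, curveReach_past_iff] using h
end
end

section
/- Let d ≥ 2 and let U ⊆ ℝ^d be open. Let g, g' : ℝ^d → Matrix (Fin d) (Fin d) ℝ be smooth Lorentzian metrics (each g(x), g'(x) symmetric and congruent to η = diag(−1, 1, …, 1)), with smooth time-orienting vector fields T, T' : ℝ^d → ℝ^d satisfying T(x)ᵀ g(x) T(x) < 0 and T'(x)ᵀ g'(x) T'(x) < 0 for all x. Suppose g(x) = g'(x) and T(x) = T'(x) for all x ∈ ℝ^d \ U. Then the causal futures of U with respect to the two metrics coincide: J⁺_g(U) = J⁺_{g'}(U), and likewise J⁻_g(U) = J⁻_{g'}(U). -/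
open Matrix Set

noncomputable section

open Filter Topology

/-- A `C¹` curve on `[a, b]` that is future-directed timelike with respect to `(g, T)`. -/
def IsTimelikePiece {d : ℕ} (g : (Fin d → ℝ) → Matrix (Fin d) (Fin d) ℝ)
    (T : (Fin d → ℝ) → Fin d → ℝ) (γ : ℝ → Fin d → ℝ) (a b : ℝ) : Prop :=
  ContDiffOn ℝ 1 γ (Icc a b) ∧ ∀ t ∈ Icc a b,
    derivWithin γ (Icc a b) t ⬝ᵥ (g (γ t)).mulVec (derivWithin γ (Icc a b) t) < 0 ∧
    derivWithin γ (Icc a b) t ⬝ᵥ (g (γ t)).mulVec (T (γ t)) < 0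

/-- The curve `γ`, pushed along `T` while keeping its value at `t = 1` fixed. -/
def pushAlong {d : ℕ} (T : (Fin d → ℝ) → Fin d → ℝ) (γ : ℝ → Fin d → ℝ) (κ ε t : ℝ) :
    Fin d → ℝ :=
  γ t + ε • ((1 - Real.exp (κ * (1 - t))) • T (γ t))

lemma ContDiff.matrix_pairing {d : ℕ} {n : WithTop ℕ∞} {E : Type*} [NormedAddCommGroup E]
    [NormedSpace ℝ E] {M : E → Matrix (Fin d) (Fin d) ℝ} {v w : E → Fin d → ℝ}
    (hM : ∀ i j, ContDiff ℝ n (fun x => M x i j)) (hv : ContDiff ℝ n v) (hw : ContDiff ℝ n w) :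
    ContDiff ℝ n (fun x => v x ⬝ᵥ (M x).mulVec (w x)) := by
  simp only [dotProduct, Matrix.mulVec]
  rw [contDiff_pi] at hv hw
  exact ContDiff.sum fun i _ => (hv i).mul (ContDiff.sum fun j _ => (hM i j).mul (hw j))

lemma IsLorentzMetric.contDiff_sq {d : ℕ} {g : (Fin d → ℝ) → Matrix (Fin d) (Fin d) ℝ}
    (hg : IsLorentzMetric d g) :
    ContDiff ℝ 1 (fun z : (Fin d → ℝ) × (Fin d → ℝ) => z.2 ⬝ᵥ (g z.1).mulVec z.2) :=
  ContDiff.matrix_pairing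
    (fun i j => ((hg.1 i j).of_le (by exact_mod_cast le_top)).comp contDiff_fst)
    contDiff_snd contDiff_snd

lemma IsLorentzMetric.contDiff_pairing {d : ℕ} {g : (Fin d → ℝ) → Matrix (Fin d) (Fin d) ℝ}
    (hg : IsLorentzMetric d g) {T : (Fin d → ℝ) → Fin d → ℝ} (hT : ContDiff ℝ 1 T) :
    ContDiff ℝ 1 (fun z : (Fin d → ℝ) × (Fin d → ℝ) => z.2 ⬝ᵥ (g z.1).mulVec (T z.1)) :=
  ContDiff.matrix_pairing
    (fun i j => ((hg.1 i j).of_le (by exact_mod_cast le_top)).comp contDiff_fst)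
    contDiff_snd (hT.comp contDiff_fst)

lemma IsLorentzMetric.fderiv_sq_vertical {d : ℕ} {g : (Fin d → ℝ) → Matrix (Fin d) (Fin d) ℝ}
    (hg : IsLorentzMetric d g) (x u w : Fin d → ℝ) :
    fderiv ℝ (fun z : (Fin d → ℝ) × (Fin d → ℝ) => z.2 ⬝ᵥ (g z.1).mulVec z.2) (x, u) (0, w) =
      2 * (u ⬝ᵥ (g x).mulVec w) := by
  have h1 : HasDerivAt (fun s : ℝ => (x, u) + s • ((0 : Fin d → ℝ), w)) (0, w) 0 := by
    simpa using ((hasDerivAt_id (0 : ℝ)).smul_const ((0 : Fin d → ℝ), w)).const_add (x, u)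
  have h2 := (hg.contDiff_sq.differentiable (by norm_num)
    ((x, u) + (0 : ℝ) • ((0 : Fin d → ℝ), w))).hasFDerivAt.comp_hasDerivAt 0 h1
  have hsymm : w ⬝ᵥ (g x).mulVec u = u ⬝ᵥ (g x).mulVec w := by
    rw [Matrix.dotProduct_mulVec, ← Matrix.mulVec_transpose, (hg.2 x).1.eq, dotProduct_comm]
  have h3 : HasDerivAt (fun s : ℝ => u ⬝ᵥ (g x).mulVec u + s * (2 * (u ⬝ᵥ (g x).mulVec w)) +
      s ^ 2 * (w ⬝ᵥ (g x).mulVec w)) (2 * (u ⬝ᵥ (g x).mulVec w)) 0 := by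
    have := (((hasDerivAt_id (0 : ℝ)).mul_const (2 * (u ⬝ᵥ (g x).mulVec w))).const_add
      (u ⬝ᵥ (g x).mulVec u)).add ((hasDerivAt_pow 2 (0 : ℝ)).mul_const (w ⬝ᵥ (g x).mulVec w))
    refine this.congr_deriv ?_
    simp
  have h4 : HasDerivAt (fun s : ℝ => u ⬝ᵥ (g x).mulVec u + s * (2 * (u ⬝ᵥ (g x).mulVec w)) +
      s ^ 2 * (w ⬝ᵥ (g x).mulVec w))
      (fderiv ℝ (fun z : (Fin d → ℝ) × (Fin d → ℝ) => z.2 ⬝ᵥ (g z.1).mulVec z.2)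
        ((x, u) + (0 : ℝ) • ((0 : Fin d → ℝ), w)) (0, w)) 0 := by
    refine h2.congr_of_eventuallyEq (Eventually.of_forall fun s => ?_)
    simp [Matrix.mulVec_add, Matrix.mulVec_smul, hsymm]
    ring
  simpa using h4.unique h3

/-- If `G ≤ 0` at the points of a compact family and `G` strictly decreases to first order in the
given directions, then `G < 0` after a small displacement, uniformly in the family. -/
lemma eventually_forall_neg_of_fderiv_neg_s7 {E : Type*} [NormedAddCommGroup E] [NormedSpace ℝ E]
    {G : E → ℝ} (hG : ContDiff ℝ 1 G) {S : Set (E × E)} (hS : IsCompact S)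
    (h0 : ∀ p ∈ S, G p.1 ≤ 0) (h1 : ∀ p ∈ S, fderiv ℝ G p.1 p.2 < 0) :
    ∀ᶠ ε in 𝓝[>] (0 : ℝ), ∀ p ∈ S, G (p.1 + ε • p.2) < 0 := by
  have hc : Continuous (fun z : ℝ × (E × E) => fderiv ℝ G (z.2.1 + z.1 • z.2.2) z.2.2) :=
    ((hG.continuous_fderiv (by norm_num)).comp (by fun_prop)).clm_apply (by fun_prop)
  have hev : ∀ᶠ ε in 𝓝 (0 : ℝ), ∀ p ∈ S, fderiv ℝ G (p.1 + ε • p.2) p.2 < 0 := by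
    refine hS.eventually_forall_of_forall_eventually fun p hp => ?_
    refine hc.continuousAt.eventually_lt_const ?_
    simpa using h1 p hp
  obtain ⟨δ, hδ, hball⟩ := Metric.eventually_nhds_iff.1 hev
  filter_upwards [Ioo_mem_nhdsGT hδ] with ε hε p hp
  have hder (s : ℝ) : HasDerivAt (fun s : ℝ => G (p.1 + s • p.2))
      (fderiv ℝ G (p.1 + s • p.2) p.2) s := by
    have h : HasDerivAt (fun s : ℝ => p.1 + s • p.2) p.2 s := by
      simpa using ((hasDerivAt_id s).smul_const p.2).const_add p.1
    exact (hG.differentiable (by norm_num) _).hasFDerivAt.comp_hasDerivAt s h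
  have hanti : StrictAntiOn (fun s : ℝ => G (p.1 + s • p.2)) (Icc 0 ε) := by
    refine strictAntiOn_of_deriv_neg (convex_Icc 0 ε)
      (fun s _ => (hder s).continuousAt.continuousWithinAt) fun s hs => ?_
    rw [interior_Icc] at hs
    rw [(hder s).deriv]
    refine hball ?_ p hp
    rw [Real.dist_eq, sub_zero, abs_of_pos hs.1]
    exact hs.2.trans hε.2
  have := hanti (left_mem_Icc.2 hε.1.le) (right_mem_Icc.2 hε.1.le) hε.1
  simp only [zero_smul, add_zero] at this
  exact this.trans_le (h0 p hp)

lemma eventually_isTimelikePiece_pushAlong {d : ℕ}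
    {g : (Fin d → ℝ) → Matrix (Fin d) (Fin d) ℝ} (hg : IsLorentzMetric d g)
    {T : (Fin d → ℝ) → Fin d → ℝ} (hT : ContDiff ℝ 1 T) {γ : ℝ → Fin d → ℝ} {a b : ℝ}
    (hab : a < b) (hb : b ≤ 1) (hγ : ContDiffOn ℝ 1 γ (Icc a b))
    (hcausal : ∀ t ∈ Icc a b,
      derivWithin γ (Icc a b) t ⬝ᵥ (g (γ t)).mulVec (derivWithin γ (Icc a b) t) ≤ 0)
    (hfuture : ∀ t ∈ Icc a b, derivWithin γ (Icc a b) t ⬝ᵥ (g (γ t)).mulVec (T (γ t)) < 0) :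
    ∀ᶠ κ in (atTop : Filter ℝ), ∀ᶠ ε in 𝓝[>] (0 : ℝ),
      IsTimelikePiece g T (pushAlong T γ κ ε) a b := by
  set v : ℝ → Fin d → ℝ := derivWithin γ (Icc a b) with hv
  have hud : UniqueDiffOn ℝ (Icc a b) := uniqueDiffOn_Icc hab
  have hγc : ContinuousOn γ (Icc a b) := hγ.continuousOn
  have hvc : ContinuousOn v (Icc a b) := hγ.continuousOn_derivWithin hud le_rfl
  have hTc : ContinuousOn (fun t => T (γ t)) (Icc a b) := hT.continuous.comp_continuousOn hγc
  have hDTc : ContinuousOn (fun t => fderiv ℝ T (γ t) (v t)) (Icc a b) :=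
    ((hT.continuous_fderiv (by norm_num)).comp_continuousOn hγc).clm_apply hvc
  set G : (Fin d → ℝ) × (Fin d → ℝ) → ℝ := fun z => z.2 ⬝ᵥ (g z.1).mulVec z.2 with hGdef
  have hG : ContDiff ℝ 1 G := hg.contDiff_sq
  have hH := hg.contDiff_pairing hT
  have hGDc : ContinuousOn (fun t => fderiv ℝ G (γ t, v t)) (Icc a b) :=
    (hG.continuous_fderiv (by norm_num)).comp_continuousOn (hγc.prodMk hvc)
  set A : ℝ → ℝ := fun t => fderiv ℝ G (γ t, v t) (0, T (γ t)) with hA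
  set B : ℝ → ℝ := fun t => fderiv ℝ G (γ t, v t) (T (γ t), fderiv ℝ T (γ t) (v t)) with hB
  have hAc : ContinuousOn A (Icc a b) := hGDc.clm_apply (continuousOn_const.prodMk hTc)
  have hBc : ContinuousOn B (Icc a b) := hGDc.clm_apply (hTc.prodMk hDTc)
  have hAneg : ∀ t ∈ Icc a b, A t < 0 := fun t ht => by
    have h1 : A t = 2 * (v t ⬝ᵥ (g (γ t)).mulVec (T (γ t))) := hg.fderiv_sq_vertical _ _ _
    have h2 := hfuture t ht
    linarith
  obtain ⟨C, hC⟩ := (isCompact_Icc.image_of_continuousOn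
    (hBc.abs.div hAc.neg fun t ht => (neg_pos.2 (hAneg t ht)).ne')).bddAbove
  filter_upwards [eventually_gt_atTop C, eventually_gt_atTop 0] with κ hκ hκ0
  set f : ℝ → ℝ := fun t => 1 - Real.exp (κ * (1 - t)) with hf
  set f' : ℝ → ℝ := fun t => κ * Real.exp (κ * (1 - t)) with hf'
  have hfd (t : ℝ) : HasDerivAt f (f' t) t := by
    have := ((((hasDerivAt_id t).const_sub 1).const_mul κ).exp).const_sub 1
    refine this.congr_deriv ?_
    simp [hf']
    ring
  have hfc : Continuous f := by fun_prop
  have hfc' : Continuous f' := by fun_prop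
  set w : ℝ → Fin d → ℝ := fun t => f' t • T (γ t) + f t • fderiv ℝ T (γ t) (v t) with hw
  have hwc : ContinuousOn w (Icc a b) :=
    (hfc'.continuousOn.smul hTc).add (hfc.continuousOn.smul hDTc)
  have hpos : ContinuousOn (fun t => (((γ t, v t), (f t • T (γ t), w t)) :
      ((Fin d → ℝ) × (Fin d → ℝ)) × ((Fin d → ℝ) × (Fin d → ℝ)))) (Icc a b) :=
    (hγc.prodMk hvc).prodMk ((hfc.continuousOn.smul hTc).prodMk hwc)
  have hS := isCompact_Icc.image_of_continuousOn hpos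
  have hfirst : ∀ t ∈ Icc a b, fderiv ℝ G (γ t, v t) (f t • T (γ t), w t) < 0 := by
    intro t ht
    have hsplit : ((f t • T (γ t), w t) : (Fin d → ℝ) × (Fin d → ℝ)) =
        f' t • (0, T (γ t)) + f t • (T (γ t), fderiv ℝ T (γ t) (v t)) := by
      simp [hw]
    have hval : fderiv ℝ G (γ t, v t) (f t • T (γ t), w t) = f' t * A t + f t * B t := by
      rw [hsplit, map_add, map_smul, map_smul, smul_eq_mul, smul_eq_mul]
    rw [hval]
    have hAt := hAneg t ht
    have h1 : |B t| < κ * (-A t) := by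
      have h2 : |B t| / (-A t) ≤ C := hC (mem_image_of_mem _ ht)
      exact (div_lt_iff₀ (neg_pos.2 hAt)).1 (h2.trans_lt hκ)
    have he1 : 1 ≤ Real.exp (κ * (1 - t)) :=
      Real.one_le_exp (mul_nonneg hκ0.le (by linarith [ht.2]))
    have h3 : f t * B t ≤ Real.exp (κ * (1 - t)) * |B t| := by
      calc f t * B t ≤ |f t * B t| := le_abs_self _
        _ = |f t| * |B t| := abs_mul _ _
        _ ≤ _ := by
          refine mul_le_mul_of_nonneg_right ?_ (abs_nonneg _)
          rw [abs_le]
          constructor <;> simp only [hf] <;> linarith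
    have h4 := mul_lt_mul_of_pos_left h1 (Real.exp_pos (κ * (1 - t)))
    simp only [hf']
    linarith
  have hquad := eventually_forall_neg_of_fderiv_neg_s7 hG hS
    (by rintro _ ⟨t, ht, rfl⟩; exact hcausal t ht) (by rintro _ ⟨t, ht, rfl⟩; exact hfirst t ht)
  have hlin : ∀ᶠ ε in 𝓝 (0 : ℝ), ∀ p ∈ (fun t => (((γ t, v t), (f t • T (γ t), w t)) :
      ((Fin d → ℝ) × (Fin d → ℝ)) × ((Fin d → ℝ) × (Fin d → ℝ)))) '' Icc a b,
      (fun z : (Fin d → ℝ) × (Fin d → ℝ) => z.2 ⬝ᵥ (g z.1).mulVec (T z.1))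
        (p.1 + ε • p.2) < 0 := by
    refine hS.eventually_forall_of_forall_eventually ?_
    rintro _ ⟨t, ht, rfl⟩
    refine (hH.continuous.comp (by fun_prop : Continuous
      fun z : ℝ × (((Fin d → ℝ) × (Fin d → ℝ)) × ((Fin d → ℝ) × (Fin d → ℝ))) =>
        z.2.1 + z.1 • z.2.2)).continuousAt.eventually_lt_const ?_
    simpa using hfuture t ht
  filter_upwards [hquad, nhdsWithin_le_nhds hlin] with ε hε1 hε2
  have hderiv : ∀ t ∈ Icc a b, derivWithin (pushAlong T γ κ ε) (Icc a b) t = v t + ε • w t := by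
    intro t ht
    have h1 : HasDerivWithinAt γ (v t) (Icc a b) t :=
      (hγ.differentiableOn (by norm_num) t ht).hasDerivWithinAt
    have h2 : HasDerivWithinAt (fun t => T (γ t)) (fderiv ℝ T (γ t) (v t)) (Icc a b) t :=
      (hT.differentiable (by norm_num) (γ t)).hasFDerivAt.comp_hasDerivWithinAt t h1
    have h3 := h1.add (((hfd t).hasDerivWithinAt.smul h2).const_smul ε)
    have h4 : HasDerivWithinAt (pushAlong T γ κ ε) (v t + ε • w t) (Icc a b) t := by
      refine h3.congr_deriv ?_
      simp only [hw]
      rw [add_comm (f t • _)]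
    exact h4.derivWithin (hud t ht)
  refine ⟨?_, fun t ht => ?_⟩
  · have hfC : ContDiff ℝ 1 f := by fun_prop
    exact hγ.add ((hfC.contDiffOn.smul (hT.comp_contDiffOn hγ)).const_smul ε)
  · rw [hderiv t ht]
    exact ⟨hε1 _ (mem_image_of_mem _ ht), hε2 _ (mem_image_of_mem _ ht)⟩

/-- Points causally reachable from an open set are chronologically reachable from it, by a
curve all of whose pieces are timelike. -/
lemma CurveReach.exists_timelike {d : ℕ}
    {g : (Fin d → ℝ) → Matrix (Fin d) (Fin d) ℝ} (hg : IsLorentzMetric d g)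
    {T : (Fin d → ℝ) → Fin d → ℝ} (hT : ContDiff ℝ 1 T) {U : Set (Fin d → ℝ)} (hU : IsOpen U)
    {p q : Fin d → ℝ} (hp : p ∈ U) (h : CurveReach d g T false true p q) :
    ∃ (m : ℕ) (s : Fin (m + 2) → ℝ) (γ : ℝ → Fin d → ℝ), StrictMono s ∧ s 0 = 0 ∧
      s (Fin.last (m + 1)) = 1 ∧ γ 0 ∈ U ∧ γ 1 = q ∧
      ∀ i : Fin (m + 1), IsTimelikePiece g T γ (s i.castSucc) (s i.succ) := by
  obtain ⟨m, s, γ, hs, hs0, hs1, hγ0, hγ1, hpiece⟩ := h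
  have hev : ∀ᶠ κ in (atTop : Filter ℝ), ∀ i : Fin (m + 1), ∀ᶠ ε in 𝓝[>] (0 : ℝ),
      IsTimelikePiece g T (pushAlong T γ κ ε) (s i.castSucc) (s i.succ) := by
    rw [eventually_all]
    intro i
    obtain ⟨h1, h2⟩ := hpiece i
    refine eventually_isTimelikePiece_pushAlong hg hT (hs i.castSucc_lt_succ) ?_ h1
      (fun t ht => ?_) (fun t ht => ?_)
    · rw [← hs1]
      exact hs.monotone (Fin.le_last _)
    · simpa using (h2 t ht).1
    · simpa using (h2 t ht).2.2
  obtain ⟨κ, hκ⟩ := hev.exists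
  have hstart : ∀ᶠ ε in 𝓝 (0 : ℝ), pushAlong T γ κ ε 0 ∈ U := by
    have hc : Continuous (fun ε : ℝ => pushAlong T γ κ ε 0) := by
      unfold pushAlong
      fun_prop
    refine hc.continuousAt.eventually_mem (hU.mem_nhds ?_)
    simpa [pushAlong, hγ0] using hp
  obtain ⟨ε, hε, hεU⟩ := ((eventually_all.2 hκ).and (nhdsWithin_le_nhds hstart)).exists
  exact ⟨m, s, pushAlong T γ κ ε, hs, hs0, hs1, hεU, by simp [pushAlong, hγ1], hε⟩

lemma IsTimelikePiece.comp_affine {d : ℕ} {g : (Fin d → ℝ) → Matrix (Fin d) (Fin d) ℝ}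
    {T : (Fin d → ℝ) → Fin d → ℝ} {γ : ℝ → Fin d → ℝ} {a b c e : ℝ} (hc : 0 < c) (hab : a < b)
    (h : IsTimelikePiece g T γ (e + a * c) (e + b * c)) :
    IsTimelikePiece g T (fun t => γ (e + t * c)) a b := by
  have hmaps : MapsTo (fun t => e + t * c) (Icc a b) (Icc (e + a * c) (e + b * c)) :=
    fun t ht => ⟨by have := mul_le_mul_of_nonneg_right ht.1 hc.le; linarith,
      by have := mul_le_mul_of_nonneg_right ht.2 hc.le; linarith⟩
  refine ⟨h.1.comp (by fun_prop) hmaps, fun t ht => ?_⟩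
  have hd1 : HasDerivWithinAt (fun t => e + t * c) c (Icc a b) t := by
    simpa using (((hasDerivAt_id t).mul_const c).const_add e).hasDerivWithinAt
  have hd2 := (h.1.differentiableOn (by norm_num) _ (hmaps ht)).hasDerivWithinAt
  have hd3 : derivWithin (fun t => γ (e + t * c)) (Icc a b) t =
      c • derivWithin γ (Icc (e + a * c) (e + b * c)) (e + t * c) :=
    (hd2.scomp t hd1 hmaps).derivWithin (uniqueDiffOn_Icc hab t ht)
  rw [hd3]
  obtain ⟨h1, h2⟩ := h.2 _ (hmaps ht)
  simp only [Matrix.mulVec_smul, smul_dotProduct, dotProduct_smul, smul_eq_mul]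
  exact ⟨mul_neg_of_pos_of_neg hc (mul_neg_of_pos_of_neg hc h1), mul_neg_of_pos_of_neg hc h2⟩

/-- Points joined by a piecewise timelike curve over an arbitrary partitioned interval are joined
by a causal curve in the sense of `CurveReach`. -/
lemma curveReach_of_isTimelikePiece {d : ℕ} {g : (Fin d → ℝ) → Matrix (Fin d) (Fin d) ℝ}
    {T : (Fin d → ℝ) → Fin d → ℝ} {m : ℕ} {s : Fin (m + 2) → ℝ} {γ : ℝ → Fin d → ℝ}
    (hs : StrictMono s)
    (h : ∀ i : Fin (m + 1), IsTimelikePiece g T γ (s i.castSucc) (s i.succ)) :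
    CurveReach d g T false true (γ (s 0)) (γ (s (Fin.last (m + 1)))) := by
  set e := s 0
  set c := s (Fin.last (m + 1)) - e with hcdef
  have hc : 0 < c := sub_pos.2 (hs (Fin.last_pos))
  have hinv (i) : e + (s i - e) / c * c = s i := by
    field_simp
    ring
  have hs' : StrictMono (fun i => (s i - e) / c) := fun i j hij =>
    (div_lt_div_iff_of_pos_right hc).2 (sub_lt_sub_right (hs hij) e)
  refine ⟨m, fun i => (s i - e) / c, fun t => γ (e + t * c), hs', ?_, div_self hc.ne', ?_, ?_,
    fun i => ?_⟩
  · simp [e]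
  · simp
  · simp [hcdef]
  · have hp : IsTimelikePiece g T (fun t => γ (e + t * c)) ((s i.castSucc - e) / c)
        ((s i.succ - e) / c) := by
      refine IsTimelikePiece.comp_affine hc (hs' i.castSucc_lt_succ) ?_
      rw [hinv, hinv]
      exact h i
    refine ⟨hp.1, fun t ht => ?_⟩
    obtain ⟨h1, h2⟩ := hp.2 t ht
    refine ⟨by simpa using h1.le, fun h0 => ?_, by simpa using h2⟩
    rw [h0] at h1
    simp at h1

/-- A timelike piece for `(g, T)` that leaves `U` for good has a final segment starting in `U`
which is timelike for any `(g', T')` agreeing with `(g, T)` outside `U`. -/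
lemma IsTimelikePiece.exists_mem_of_eq_outside {d : ℕ}
    {U : Set (Fin d → ℝ)} (hU : IsOpen U)
    {g g' : (Fin d → ℝ) → Matrix (Fin d) (Fin d) ℝ} (hg' : IsLorentzMetric d g')
    {T T' : (Fin d → ℝ) → Fin d → ℝ} (hT' : ContDiff ℝ 1 T')
    (heq : ∀ x ∉ U, g x = g' x ∧ T x = T' x) {γ : ℝ → Fin d → ℝ} {a b : ℝ} (hab : a < b)
    (h : IsTimelikePiece g T γ a b) (hmem : ∃ t ∈ Icc a b, γ t ∈ U) (hb : γ b ∉ U) :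
    ∃ t ∈ Ico a b, γ t ∈ U ∧ IsTimelikePiece g' T' γ t b := by
  have hγc : ContinuousOn γ (Icc a b) := h.1.continuousOn
  have hvc : ContinuousOn (derivWithin γ (Icc a b)) (Icc a b) :=
    h.1.continuousOn_derivWithin (uniqueDiffOn_Icc hab) le_rfl
  set S : Set ℝ := {t | t ∈ Icc a b ∧ γ t ∈ U}
  have hSne : S.Nonempty := hmem
  have hSbdd : BddAbove S := ⟨b, fun t ht => ht.1.2⟩
  set t₀ := sSup S
  have ht₀ : t₀ ∈ Icc a b := by
    obtain ⟨t, ht⟩ := hSne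
    exact ⟨ht.1.1.trans (le_csSup hSbdd ht), csSup_le ⟨t, ht⟩ fun t ht => ht.1.2⟩
  have ht₀U : γ t₀ ∉ U := by
    intro hin
    have hlt : t₀ < b := lt_of_le_of_ne ht₀.2 fun h => hb (h ▸ hin)
    have hev : ∀ᶠ t in 𝓝[Icc a b] t₀, γ t ∈ U := (hγc t₀ ht₀).eventually_mem (hU.mem_nhds hin)
    have hev2 : ∀ᶠ t in 𝓝[>] t₀, t ∈ Icc a b → γ t ∈ U :=
      nhdsWithin_le_nhds (eventually_nhdsWithin_iff.1 hev)
    obtain ⟨t, ht, htI⟩ := (hev2.and (Ioo_mem_nhdsGT hlt)).exists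
    have htab : t ∈ Icc a b := ⟨ht₀.1.trans htI.1.le, htI.2.le⟩
    exact absurd (le_csSup hSbdd ⟨htab, ht htab⟩) (not_le.2 htI.1)
  have hafter : ∀ t ∈ Icc a b, t₀ ≤ t → γ t ∉ U := by
    intro t ht hle hin
    rcases hle.eq_or_lt with rfl | hlt
    · exact ht₀U hin
    · exact absurd (le_csSup hSbdd ⟨ht, hin⟩) (not_le.2 hlt)
  have hout : ∀ t ∈ Icc a b, t₀ ≤ t →
      derivWithin γ (Icc a b) t ⬝ᵥ (g' (γ t)).mulVec (derivWithin γ (Icc a b) t) < 0 ∧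
      derivWithin γ (Icc a b) t ⬝ᵥ (g' (γ t)).mulVec (T' (γ t)) < 0 := by
    intro t ht hle
    obtain ⟨h1, h2⟩ := heq _ (hafter t ht hle)
    rw [← h1, ← h2]
    exact h.2 t ht
  have hnear : ∀ᶠ t in 𝓝[Icc a b] t₀,
      derivWithin γ (Icc a b) t ⬝ᵥ (g' (γ t)).mulVec (derivWithin γ (Icc a b) t) < 0 ∧
      derivWithin γ (Icc a b) t ⬝ᵥ (g' (γ t)).mulVec (T' (γ t)) < 0 := by
    have hz := hγc.prodMk hvc
    exact ((hg'.contDiff_sq.continuous.comp_continuousOn hz t₀ ht₀).eventually_lt_const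
      (hout t₀ ht₀ le_rfl).1).and
      ((((hg'.contDiff_pairing hT').continuous.comp_continuousOn hz) t₀ ht₀).eventually_lt_const
      (hout t₀ ht₀ le_rfl).2)
  obtain ⟨δ, hδ, hball⟩ := Metric.eventually_nhds_iff.1 (eventually_nhdsWithin_iff.1 hnear)
  obtain ⟨t₁, ht₁, hlt⟩ := exists_lt_of_lt_csSup hSne (sub_lt_self t₀ hδ)
  have hle : t₁ ≤ t₀ := le_csSup hSbdd ht₁
  have ht₁b : t₁ < b := lt_of_le_of_ne ht₁.1.2 fun h => hb (h ▸ ht₁.2)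
  refine ⟨t₁, ⟨ht₁.1.1, ht₁b⟩, ht₁.2, ?_⟩
  have hsub : Icc t₁ b ⊆ Icc a b := Icc_subset_Icc_left ht₁.1.1
  refine ⟨h.1.mono hsub, fun t ht => ?_⟩
  rw [derivWithin_subset hsub (uniqueDiffOn_Icc ht₁b t ht)
    (h.1.differentiableOn (by norm_num) t (hsub ht))]
  rcases le_total t₀ t with hc | hc
  · exact hout t (hsub ht) hc
  · refine hball ?_ (hsub ht)
    rw [Real.dist_eq, abs_lt]
    constructor <;> linarith [ht.1]

lemma causalSet_future_subset {d : ℕ} {U : Set (Fin d → ℝ)} (hU : IsOpen U)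
    {g g' : (Fin d → ℝ) → Matrix (Fin d) (Fin d) ℝ}
    (hg : IsLorentzMetric d g) (hg' : IsLorentzMetric d g')
    {T T' : (Fin d → ℝ) → Fin d → ℝ} (hT : ContDiff ℝ 1 T) (hT' : ContDiff ℝ 1 T')
    (heq : ∀ x ∉ U, g x = g' x ∧ T x = T' x) :
    causalSet d g T true U ⊆ causalSet d g' T' true U := by
  rintro q ⟨p, hp, hpq⟩
  by_cases hq : q ∈ U
  · exact ⟨q, hq, Or.inl rfl⟩
  have hreach : CurveReach d g T false true p q := by
    rcases hpq with rfl | h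
    · exact absurd hp hq
    · exact h
  obtain ⟨m, s, γ, hs, hs0, hs1, hγ0, hγ1, hpiece⟩ := hreach.exists_timelike hg hT hU hp
  obtain ⟨j, hj, hmax⟩ : ∃ j : Fin (m + 1), (∃ t ∈ Icc (s j.castSucc) (s j.succ), γ t ∈ U) ∧
      ∀ i : Fin (m + 1), j < i → ∀ t ∈ Icc (s i.castSucc) (s i.succ), γ t ∉ U := by
    have hfin : ({j : Fin (m + 1) | ∃ t ∈ Icc (s j.castSucc) (s j.succ), γ t ∈ U}).Finite :=
      Set.toFinite _
    have hne : ({j : Fin (m + 1) | ∃ t ∈ Icc (s j.castSucc) (s j.succ), γ t ∈ U}).Nonempty := by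
      refine ⟨0, s 0, ⟨le_rfl, (hs (Fin.succ_pos 0)).le⟩, ?_⟩
      rwa [hs0]
    obtain ⟨j, hj⟩ := hfin.exists_maximal hne
    exact ⟨j, hj.1, fun i hi t ht htU => absurd (hj.2 ⟨t, ht, htU⟩ hi.le) (not_le.2 hi)⟩
  have hend : γ (s j.succ) ∉ U := by
    rcases eq_or_ne j (Fin.last m) with rfl | hne
    · rw [Fin.succ_last, hs1, hγ1]
      exact hq
    · have hlt : (j : ℕ) < m := by
        have := Fin.val_lt_last hne
        simpa using this
      have hcs : j.succ = (⟨j + 1, by omega⟩ : Fin (m + 1)).castSucc := by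
        ext
        simp
      refine hmax ⟨j + 1, by omega⟩ (Fin.lt_def.2 (by simp)) _ ?_
      rw [hcs]
      exact ⟨le_rfl, (hs (Fin.castSucc_lt_succ)).le⟩
  obtain ⟨t₁, ht₁, ht₁U, hfirst⟩ := (hpiece j).exists_mem_of_eq_outside hU hg' hT' heq
    (hs j.castSucc_lt_succ) hj hend
  have hjm : (j : ℕ) ≤ m := Nat.lt_succ_iff.1 j.2
  set s' : Fin (m - j + 2) → ℝ :=
    Fin.cons t₁ (fun i : Fin (m - j + 1) => s ⟨j + 1 + i, by omega⟩) with hs'def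
  have hs' : StrictMono s' := by
    rw [Fin.strictMono_iff_lt_succ]
    intro i
    refine Fin.cases ?_ (fun k => ?_) i
    · exact ht₁.2
    · rw [← Fin.succ_castSucc]
      simp only [hs'def, Fin.cons_succ]
      exact hs (Fin.lt_def.2 (by simp))
  have hpiece' : ∀ i : Fin (m - j + 1),
      IsTimelikePiece g' T' γ (s' i.castSucc) (s' i.succ) := by
    intro i
    refine Fin.cases ?_ (fun k => ?_) i
    · exact hfirst
    · rw [← Fin.succ_castSucc]
      simp only [hs'def, Fin.cons_succ]
      have hk : (j : ℕ) + 1 + k < m + 1 := by omega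
      obtain ⟨h1, h2⟩ := hpiece ⟨j + 1 + k, hk⟩
      refine ⟨h1, fun t ht => ?_⟩
      obtain ⟨e1, e2⟩ := heq (γ t)
        (hmax ⟨j + 1 + k, hk⟩ (Fin.lt_def.2 (by simp; omega)) t ht)
      have h3 := h2 t ht
      rw [e1, e2] at h3
      exact h3
  have hlast : s' (Fin.last (m - j + 1)) = 1 := by
    rw [← Fin.succ_last, hs'def, Fin.cons_succ, ← hs1]
    congr 1
    ext
    simp
    omega
  have hfinal := curveReach_of_isTimelikePiece hs' hpiece'
  rw [hlast, hγ1] at hfinal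
  exact ⟨γ t₁, ht₁U, Or.inr hfinal⟩

lemma causalSet_past_eq_future_neg {d : ℕ} (g : (Fin d → ℝ) → Matrix (Fin d) (Fin d) ℝ)
    (T : (Fin d → ℝ) → Fin d → ℝ) (U : Set (Fin d → ℝ)) :
    causalSet d g T false U = causalSet d g (fun x => -T x) true U := by
  simp [causalSet, CurveReach, Matrix.mulVec_neg]

/-- If two smooth time-oriented Lorentzian metrics `g, g'` on `ℝ^d`
(`d ≥ 2`), with time orientations `T, T'`, coincide outside an open set `U`, then the
causal futures and pasts of `U` with respect to the two metrics coincide: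
`J⁺_g(U) = J⁺_{g'}(U)` and `J⁻_g(U) = J⁻_{g'}(U)`. -/
theorem causal_sets_eq_of_metrics_eq_outside
    (d : ℕ) (hd : 2 ≤ d) (U : Set (Fin d → ℝ)) (hU : IsOpen U)
    (g g' : (Fin d → ℝ) → Matrix (Fin d) (Fin d) ℝ)
    (hg : IsLorentzMetric d g) (hg' : IsLorentzMetric d g')
    (T T' : (Fin d → ℝ) → Fin d → ℝ)
    (hT : IsTimeOrientation d g T) (hT' : IsTimeOrientation d g' T')
    (heq : ∀ x ∉ U, g x = g' x ∧ T x = T' x) :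
    causalSet d g T true U = causalSet d g' T' true U ∧
    causalSet d g T false U = causalSet d g' T' false U := by
  have h1 : ContDiff ℝ 1 T := hT.1.of_le (by exact_mod_cast le_top)
  have h1' : ContDiff ℝ 1 T' := hT'.1.of_le (by exact_mod_cast le_top)
  have heq' : ∀ x ∉ U, g' x = g x ∧ T' x = T x :=
    fun x hx => ⟨(heq x hx).1.symm, (heq x hx).2.symm⟩
  refine ⟨(causalSet_future_subset hU hg hg' h1 h1' heq).antisymm
    (causalSet_future_subset hU hg' hg h1' h1 heq'), ?_⟩
  rw [causalSet_past_eq_future_neg, causalSet_past_eq_future_neg]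
  exact (causalSet_future_subset hU hg hg' h1.neg h1'.neg
    fun x hx => ⟨(heq x hx).1, congrArg _ (heq x hx).2⟩).antisymm
    (causalSet_future_subset hU hg' hg h1'.neg h1.neg
      fun x hx => ⟨(heq' x hx).1, congrArg _ (heq' x hx).2⟩)
end
end

section
/- Let T, R : ℝ → ℝ be differentiable functions and s₀ ∈ ℝ. Suppose |R'(s)| ≤ T'(s) for all s ≥ s₀ (the curve s ↦ (T(s), R(s)) is future-directed causal for the 1+1 metric −dT² + dR²), and suppose T(s₀) > |R(s₀)|. Then T(s) > |R(s)| for all s ≥ s₀; in particular T(s)² − R(s)² > 0 for all s ≥ s₀, so the curve never meets any level set {(T,R) : T² − R² = c} with c ≤ 0. -/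
/-- A future-directed causal curve `s ↦ (T(s), R(s))` for the 1+1 metric
`−dT² + dR²` (i.e. `|R'| ≤ T'`) that starts in the black hole region `{T > |R|}` stays in it:
`T(s) > |R(s)|`, hence `T(s)² − R(s)² > 0`, for all `s ≥ s₀`. -/
theorem black_hole_region_future_invariant
    (T R : ℝ → ℝ) (hT : Differentiable ℝ T) (hR : Differentiable ℝ R)
    (s₀ : ℝ) (hc : ∀ s, s₀ ≤ s → |deriv R s| ≤ deriv T s)
    (h0 : |R s₀| < T s₀) :
    ∀ s, s₀ ≤ s → |R s| < T s ∧ 0 < (T s) ^ 2 - (R s) ^ 2 := by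
  intro s hs
  have hsub : MonotoneOn (T - R) (Set.Ici s₀) := by
    refine monotoneOn_of_deriv_nonneg (convex_Ici s₀) (hT.sub hR).continuous.continuousOn
      (hT.sub hR).differentiableOn fun x hx => ?_
    have h := abs_le.1 (hc x (interior_subset hx))
    rw [deriv_sub (hT x) (hR x)]
    linarith [h.2]
  have hadd : MonotoneOn (T + R) (Set.Ici s₀) := by
    refine monotoneOn_of_deriv_nonneg (convex_Ici s₀) (hT.add hR).continuous.continuousOn
      (hT.add hR).differentiableOn fun x hx => ?_
    have h := abs_le.1 (hc x (interior_subset hx))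
    rw [deriv_add (hT x) (hR x)]
    linarith [h.1]
  have h₁ : T s₀ - R s₀ ≤ T s - R s := hsub Set.self_mem_Ici hs hs
  have h₂ : T s₀ + R s₀ ≤ T s + R s := hadd Set.self_mem_Ici hs hs
  obtain ⟨h₃, h₄⟩ := abs_lt.1 h0
  have h : |R s| < T s := abs_lt.2 ⟨by linarith, by linarith⟩
  exact ⟨h, sub_pos.2 (sq_lt_sq.2 (h.trans_le (le_abs_self _)))⟩
end

section
/- Let H > 0, let E be a real normed vector space, and let x : ℝ → E be differentiable with ‖x'(t)‖ ≤ 1 / cosh(H t) for all t ∈ ℝ. Then for all t₀ ≤ t₁, ‖x(t₁) − x(t₀)‖ ≤ η(t₁) − η(t₀) < π/H, where η(t) = (π/2 + arctan(sinh(H t))) / H. -/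
open Real

theorem hasDerivAt_bigBounce_conformalTime {H : ℝ} (hH : H ≠ 0) (t : ℝ) :
    HasDerivAt (fun t => (π / 2 + Real.arctan (Real.sinh (H * t))) / H)
      (Real.cosh (H * t))⁻¹ t := by
  have hlin : HasDerivAt (fun t : ℝ => H * t) H t := by
    simpa using (hasDerivAt_id t).const_mul H
  refine ((hlin.sinh.arctan.const_add (π / 2)).div_const H).congr_deriv ?_
  have hcosh : Real.cosh (H * t) ≠ 0 := (Real.cosh_pos _).ne'
  rw [add_comm 1, ← Real.cosh_sq]
  field_simp

/-- A causal curve `t ↦ (t, x(t))` of the Big Bounce metric (that is,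
`‖x'(t)‖ ≤ 1/cosh(H t)`) traverses spatial distance at most the elapsed conformal time
`η(t₁) − η(t₀)`, which is always less than `π/H`, where
`η(t) = (π/2 + arctan(sinh(H t)))/H`. -/
theorem causal_curve_spatial_distance_bound
    (H : ℝ) (hH : 0 < H) {E : Type*} [NormedAddCommGroup E] [NormedSpace ℝ E]
    (x : ℝ → E) (hx : Differentiable ℝ x)
    (hx' : ∀ t, ‖deriv x t‖ ≤ (Real.cosh (H * t))⁻¹)
    (η : ℝ → ℝ)
    (hη : ∀ t, η t = (π / 2 + Real.arctan (Real.sinh (H * t))) / H) :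
    ∀ t₀ t₁, t₀ ≤ t₁ →
      ‖x t₁ - x t₀‖ ≤ η t₁ - η t₀ ∧ η t₁ - η t₀ < π / H := by
  obtain rfl : η = fun t => (π / 2 + Real.arctan (Real.sinh (H * t))) / H := funext hη
  intro t₀ t₁ h
  constructor
  · refine image_norm_le_of_norm_deriv_right_le_deriv_boundary
      (f := fun t => x t - x t₀) (f' := deriv x) (hx.continuous.sub continuous_const).continuousOn
      (fun t _ => ((hx t).hasDerivAt.sub_const _).hasDerivWithinAt) (by simp)
      (fun t => (hasDerivAt_bigBounce_conformalTime hH.ne' t).sub_const _)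
      (fun t _ => hx' t) (Set.right_mem_Icc.2 h)
  · simp only [← sub_div]
    gcongr
    linarith [Real.arctan_lt_pi_div_two (Real.sinh (H * t₁)),
      Real.neg_pi_div_two_lt_arctan (Real.sinh (H * t₀))]
end

section
/- Let H > 0, let R > π/H, let E be a real normed vector space, and let x : ℝ → E be differentiable with ‖x'(t)‖ ≤ 1 / cosh(H t) for all t. Write η(t) = (π/2 + arctan(sinh(H t))) / H. If ‖x(t₀)‖ < η(t₀) + R − π/H for some t₀, then ‖x(t)‖ < R for all t ≥ t₀. In particular, no future-directed causal curve of the Big Bounce metric starting in the region U = {(t,x) : ‖x‖ < η(t) + R − π/H} ever reaches the cylinder boundary {‖x‖ = R}. -/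
open Real

/-- The conformal time of the Big Bounce metric has derivative `1 / cosh (H t)`. -/
theorem hasDerivAt_conformalTime {H : ℝ} (hH : H ≠ 0) (t : ℝ) :
    HasDerivAt (fun s => (π / 2 + arctan (sinh (H * s))) / H) (cosh (H * t))⁻¹ t := by
  have h := ((((hasDerivAt_id' t).const_mul H).sinh.arctan).const_add (π / 2)).div_const H
  have hc : cosh (H * t) ≠ 0 := (cosh_pos _).ne'
  refine h.congr_deriv ?_
  rw [← cosh_sq']
  field_simp

/-- In the Big Bounce spacetime with `R > π/H`, a causal curve
`t ↦ (t, x(t))` (i.e. `‖x'(t)‖ ≤ 1/cosh(H t)`) that starts in the region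
`U = {(t,x) : ‖x‖ < η(t) + R − π/H}` never reaches the cylinder boundary `{‖x‖ = R}`:
`‖x(t)‖ < R` for all `t ≥ t₀`. -/
theorem causal_curve_from_U_misses_boundary
    (H : ℝ) (hH : 0 < H) (R : ℝ) (hR : π / H < R)
    {E : Type*} [NormedAddCommGroup E] [NormedSpace ℝ E]
    (x : ℝ → E) (hx : Differentiable ℝ x)
    (hx' : ∀ t, ‖deriv x t‖ ≤ (Real.cosh (H * t))⁻¹)
    (η : ℝ → ℝ)
    (hη : ∀ t, η t = (π / 2 + Real.arctan (Real.sinh (H * t))) / H)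
    (t₀ : ℝ) (h0 : ‖x t₀‖ < η t₀ + R - π / H) :
    ∀ t, t₀ ≤ t → ‖x t‖ < R := by
  intro t ht
  have hη' : ∀ s, HasDerivAt η (cosh (H * s))⁻¹ s := by
    rw [funext hη]
    exact hasDerivAt_conformalTime hH.ne'
  have hle : ‖x t‖ ≤ ‖x t₀‖ - η t₀ + η t :=
    image_norm_le_of_norm_deriv_right_le_deriv_boundary hx.continuous.continuousOn
      (fun s _ => (hx s).hasDerivAt.hasDerivWithinAt) (by simp)
      (fun s => (hη' s).const_add (‖x t₀‖ - η t₀)) (fun s _ => hx' s) ⟨ht, le_rfl⟩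
  have hlt : η t < π / H := by
    rw [hη]
    gcongr
    linarith [arctan_lt_pi_div_two (sinh (H * t))]
  linarith
end
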